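/- Let G be a position in which every component is a 3-chain or a 4-loop. Then: v(G) is whichever of 0 and 4 is congruent to size(G) mod 8, if θ(G) = 0; v(G) = 3 if θ(G) = 1 and f(G) is even; and otherwise v(G) is whichever of 1 and 2 is congruent to size(G) mod 2. Furthermore, if G contains a 4-loop, then opening a 4-loop is optimal if and only if θ(G) is even or θ(G) = 1; and if G contains a 3-chain, then opening a 3-chain is optimal if and only if θ(G) ≥ 2 or f(G) is even. -/

import Mathlib

namespace DotsAndBoxes

/-- A component of a Dots & Boxes endgame position: an `n`-chain or an `n`-loop. -/
inductive Component : Type where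
  | chain (n : ℕ)
  | loop (n : ℕ)
deriving DecidableEq

namespace Component

/-- The number of boxes in a component. -/
def size : Component → ℕ
  | chain n => n
  | loop n => n

def isChain : Component → Bool
  | chain _ => true
  | loop _ => false

def isLoop : Component → Bool
  | chain _ => false
  | loop _ => true

/-- A chain must have length at least 3; a loop must have even length at least 4. -/
def Valid : Component → Prop
  | chain n => 3 ≤ n
  | loop n => 4 ≤ n ∧ Even n

end Component

/-- A position is a finite multiset of components. -/
abbrev Position := Multiset Component

def Position.Valid (G : Position) : Prop := ∀ C ∈ G, C.Valid

/-- The number of unclaimed boxes in a position. -/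
def size (G : Position) : ℕ := (G.map Component.size).sum

/-- The number of chains of a position. -/
def numChains (G : Position) : ℕ := Multiset.card (G.filter fun C => C.isChain = true)

/-- The number of loops of a position. -/
def numLoops (G : Position) : ℕ := Multiset.card (G.filter fun C => C.isLoop = true)

/-- θ(G), the number of 3-chains. -/
def theta (G : Position) : ℕ := G.count (Component.chain 3)

/-- f(G), the number of 4-loops. -/
def numF (G : Position) : ℕ := G.count (Component.loop 4)

/-- s(G), the number of 6-loops. -/
def numS (G : Position) : ℕ := G.count (Component.loop 6)

open Classical in
/-- The terminal bonus tb(G). -/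
noncomputable def tb (G : Position) : ℤ :=
  if G = 0 then 0
  else if ∀ C ∈ G, C.isLoop = true then 8
  else if (∃ C ∈ G, C.isLoop = true) ∧ Component.chain 3 ∈ G ∧
      (∀ C ∈ G, C.isChain = true → C = Component.chain 3) then 6
  else 4

/-- The controlled value c(G). -/
noncomputable def cval (G : Position) : ℤ :=
  (size G : ℤ) - 4 * (numChains G : ℤ) - 8 * (numLoops G : ℤ) + tb G

/-- The score v(G;C) of opening component `C`, given that the remainder of the
position has value `w`. -/
def openVal (C : Component) (w : ℤ) : ℤ :=
  match C with
  | Component.chain n => ((n : ℤ) - 2) + |w - 2|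
  | Component.loop n => ((n : ℤ) - 4) + |w - 4|

/-- Auxiliary recursion (on the number of components) for the value `v`. -/
noncomputable def valueAux : ℕ → Position → ℤ
  | 0, _ => 0
  | n + 1, G =>
    if G = 0 then 0
    else sInf { x : ℤ | ∃ C ∈ G, x = openVal C (valueAux n (G.erase C)) }

/-- The value v(G): v(∅) = 0, and v(G) = min over components C of G of v(G;C). -/
noncomputable def value (G : Position) : ℤ := valueAux (Multiset.card G) G

/-- v(G;C), the value of G given that the opener has just opened C. -/
noncomputable def valueOpen (G : Position) (C : Component) : ℤ :=
  openVal C (value (G.erase C))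

/-- Opening a component C of G is optimal if C ∈ G and v(G;C) = v(G). -/
def Optimal (G : Position) (C : Component) : Prop :=
  C ∈ G ∧ valueOpen G C = value G


def W (t f : ℕ) : ℤ :=
  if t = 0 then (if f % 2 = 0 then 0 else 4)
  else if t = 1 ∧ f % 2 = 0 then 3
  else if t % 2 = 1 then 1 else 2

/-- Opening a chain. -/
lemma W_chain (t f : ℕ) :
    W (t + 1) f ≤ 1 + |W t f - 2| ∧
      (1 + |W t f - 2| = W (t + 1) f ↔ (2 ≤ t + 1 ∨ f % 2 = 0)) := by
  unfold W
  simp only [abs_eq_max_neg]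
  split_ifs <;> first | contradiction | omega

/-- Opening a loop. -/
lemma W_loop (t f : ℕ) :
    W t (f + 1) ≤ |W t f - 4| ∧
      (|W t f - 4| = W t (f + 1) ↔ (t % 2 = 0 ∨ t = 1)) := by
  unfold W
  simp only [abs_eq_max_neg]
  split_ifs <;> first | contradiction | omega

lemma openVal_chain3 (w : ℤ) : openVal (Component.chain 3) w = 1 + |w - 2| := by
  norm_num [openVal]

lemma openVal_loop4 (w : ℤ) : openVal (Component.loop 4) w = |w - 4| := by
  norm_num [openVal]

lemma theta_chain {G : Position} (h : Component.chain 3 ∈ G) :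
    theta G = theta (G.erase (Component.chain 3)) + 1 ∧
      numF G = numF (G.erase (Component.chain 3)) := by
  unfold theta numF
  have := Multiset.count_pos.mpr h
  rw [Multiset.count_erase_self, Multiset.count_erase_of_ne (by decide)]
  omega

lemma theta_loop {G : Position} (h : Component.loop 4 ∈ G) :
    theta G = theta (G.erase (Component.loop 4)) ∧
      numF G = numF (G.erase (Component.loop 4)) + 1 := by
  unfold theta numF
  have := Multiset.count_pos.mpr h
  rw [Multiset.count_erase_self, Multiset.count_erase_of_ne (by decide)]
  omega

lemma valueAux_eq (n : ℕ) : ∀ G : Position, Multiset.card G = n →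
    (∀ C ∈ G, C = Component.chain 3 ∨ C = Component.loop 4) →
    valueAux n G = W (theta G) (numF G) := by
  induction n with
  | zero =>
    intro G h _
    rw [Multiset.card_eq_zero] at h
    subst h
    simp [valueAux, W, theta, numF]
  | succ n ih =>
    intro G h hG
    have h0 : G ≠ 0 := by rintro rfl; simp at h
    rw [valueAux, if_neg h0]
    have ih' : ∀ C ∈ G, valueAux n (G.erase C) = W (theta (G.erase C)) (numF (G.erase C)) := by
      intro C hC
      apply ih
      · rw [Multiset.card_erase_of_mem hC, h]; rfl
      · exact fun D hD => hG D (Multiset.mem_of_mem_erase hD)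
    have hc : ∀ hC : Component.chain 3 ∈ G, W (theta G) (numF G) ≤
        openVal (Component.chain 3) (valueAux n (G.erase (Component.chain 3))) ∧
        (openVal (Component.chain 3) (valueAux n (G.erase (Component.chain 3))) =
          W (theta G) (numF G) ↔ (2 ≤ theta G ∨ numF G % 2 = 0)) := by
      intro hC
      obtain ⟨h1, h2⟩ := theta_chain hC
      rw [ih' _ hC, openVal_chain3, h1, h2]
      exact W_chain _ _
    have hl : ∀ hC : Component.loop 4 ∈ G, W (theta G) (numF G) ≤
        openVal (Component.loop 4) (valueAux n (G.erase (Component.loop 4))) ∧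
        (openVal (Component.loop 4) (valueAux n (G.erase (Component.loop 4))) =
          W (theta G) (numF G) ↔ (theta G % 2 = 0 ∨ theta G = 1)) := by
      intro hC
      obtain ⟨h1, h2⟩ := theta_loop hC
      rw [ih' _ hC, openVal_loop4, h1, h2]
      exact W_loop _ _
    apply IsLeast.csInf_eq
    constructor
    · by_cases ht : 2 ≤ theta G ∨ (theta G = 1 ∧ numF G % 2 = 0)
      · have hC : Component.chain 3 ∈ G := by
          apply Multiset.count_pos.mp
          change 0 < theta G
          omega
        exact ⟨_, hC, ((hc hC).2.mpr (by omega)).symm⟩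
      · have hC : Component.loop 4 ∈ G := by
          obtain ⟨D, hD⟩ := Multiset.exists_mem_of_ne_zero h0
          rcases hG D hD with rfl | rfl
          · have : 0 < theta G := Multiset.count_pos.mpr hD
            apply Multiset.count_pos.mp
            change 0 < numF G
            omega
          · exact hD
        exact ⟨_, hC, ((hl hC).2.mpr (by omega)).symm⟩
    · rintro x ⟨C, hC, rfl⟩
      rcases hG C hC with rfl | rfl
      · exact (hc hC).1
      · exact (hl hC).1

lemma size_eq (G : Position) (hG : ∀ C ∈ G, C = Component.chain 3 ∨ C = Component.loop 4) :
    size G = 3 * theta G + 4 * numF G := by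
  induction G using Multiset.induction_on with
  | empty => simp [size, theta, numF]
  | cons a s ih =>
    have := ih (fun C hC => hG C (Multiset.mem_cons_of_mem hC))
    unfold size theta numF at *
    rcases hG a (Multiset.mem_cons_self a s) with rfl | rfl
    · rw [Multiset.map_cons, Multiset.sum_cons, Multiset.count_cons_self,
        Multiset.count_cons_of_ne (by decide), this]
      simp only [Component.size]
      ring
    · rw [Multiset.map_cons, Multiset.sum_cons, Multiset.count_cons_self,
        Multiset.count_cons_of_ne (by decide), this]
      simp only [Component.size]
      ring

/-- Positions made of 3-chains and 4-loops: the value of G, and exactly when opening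
a 4-loop (resp. a 3-chain) is optimal. -/
theorem threes_and_four_loops (G : Position)
    (hG : ∀ C ∈ G, C = Component.chain 3 ∨ C = Component.loop 4) :
    ((theta G = 0 → (size G % 8 = 0 → value G = 0) ∧ (size G % 8 = 4 → value G = 4)) ∧
     ((theta G = 1 ∧ Even (numF G)) → value G = 3) ∧
     ((¬ theta G = 0 ∧ ¬ (theta G = 1 ∧ Even (numF G))) →
        (Odd (size G) → value G = 1) ∧ (Even (size G) → value G = 2))) ∧
    (Component.loop 4 ∈ G →
      (Optimal G (Component.loop 4) ↔ (Even (theta G) ∨ theta G = 1))) ∧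
    (Component.chain 3 ∈ G →
      (Optimal G (Component.chain 3) ↔ (2 ≤ theta G ∨ Even (numF G)))) := by
  have hv : ∀ H : Position, (∀ C ∈ H, C = Component.chain 3 ∨ C = Component.loop 4) →
      value H = W (theta H) (numF H) := fun H hH => valueAux_eq _ H rfl hH
  have hs := size_eq G hG
  have he : ∀ D, ∀ C ∈ G.erase D, C = Component.chain 3 ∨ C = Component.loop 4 :=
    fun D C hC => hG C (Multiset.mem_of_mem_erase hC)
  refine ⟨?_, ?_, ?_⟩
  · rw [hv G hG, hs]
    generalize theta G = t
    generalize numF G = f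
    simp only [Nat.even_iff, Nat.odd_iff]
    unfold W
    split_ifs <;> omega
  · intro hC
    obtain ⟨h1, h2⟩ := theta_loop hC
    unfold Optimal valueOpen
    rw [hv G hG, hv _ (he _), openVal_loop4, Nat.even_iff, h1, h2]
    simp only [hC, true_and]
    exact (W_loop _ _).2
  · intro hC
    obtain ⟨h1, h2⟩ := theta_chain hC
    unfold Optimal valueOpen
    rw [hv G hG, hv _ (he _), openVal_chain3, Nat.even_iff, h1, h2]
    simp only [hC, true_and]
    exact (W_chain _ _).2


end DotsAndBoxes
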